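/- For every constant C₀ ≥ 1 there exist constants c, C > 0 depending only on C₀ such that the following holds: for every n ∈ ℕ, all 1-symmetric quasi-norms ‖·‖_X, ‖·‖_Y on ℝ^n with quasi-norm constants at most C₀, and every integer s with 1 ≤ s < n/2, one has c · u(X, Y, s) ≤ sup{σ_s(x)_Y : x ∈ ℝ^n, ‖x‖_X ≤ 1} ≤ C · u(X, Y, s), where σ_s(x)_Y = inf{‖x − z‖_Y : z ∈ ℝ^n has at most s nonzero coordinates} is the error of best s-term approximation and u(X, Y, s) = sup{ ‖(min{x_s^*, x_i^*})_{i=1}^n‖_Y : ‖x‖_X ≤ 1 } with x* the non-increasing rearrangement of x. -/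

import Mathlib

open scoped ENNReal Classical
open MeasureTheory

/-- The non-increasing rearrangement of `x : ℝ^n`: for `1 ≤ i ≤ n`,
`rearr n x i` is the `i`-th largest of the absolute values of the entries of `x`,
defined via `x_i^* = inf {t ≥ 0 : #{j : |x j| > t} ≤ i - 1}`. -/
noncomputable def rearr (n : ℕ) (x : Fin n → ℝ) (i : ℕ) : ℝ :=
  sInf {t : ℝ | 0 ≤ t ∧ ((Finset.univ : Finset (Fin n)).filter (fun j => t < |x j|)).card ≤ i - 1}

/-- The Lorentz quasi-norm `‖x‖_{p,u}` on `ℝ^n` for `p, u ∈ (0,∞]`, with the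
convention `1/∞ = 0`:  `‖x‖_{p,u} = (∑_{i=1}^n i^{u/p-1} (x_i^*)^u)^{1/u}` for `u < ∞`
and `‖x‖_{p,∞} = max_{1 ≤ i ≤ n} i^{1/p} x_i^*`. -/
noncomputable def lorentzNorm (n : ℕ) (p u : ℝ≥0∞) (x : Fin n → ℝ) : ℝ :=
  if u = ⊤ then
    sSup {t : ℝ | ∃ i ∈ Finset.Icc 1 n, t = (i : ℝ) ^ (1 / p).toReal * rearr n x i}
  else
    (∑ i ∈ Finset.Icc 1 n, (i : ℝ) ^ ((u / p).toReal - 1) * rearr n x i ^ u.toReal) ^ (1 / u.toReal)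

/-- The `k`-th (dyadic) entropy number of the identity map from `(ℝ^n, NX)` to `(ℝ^n, NY)`:
`e_k = inf {ε > 0 : ∃ y_1, …, y_{2^{k-1}} with B_X ⊆ ⋃ (y_i + ε B_Y)}`. -/
noncomputable def entropyNumber (n : ℕ) (NX NY : (Fin n → ℝ) → ℝ) (k : ℕ) : ℝ :=
  sInf {ε : ℝ | 0 < ε ∧ ∃ T : Finset (Fin n → ℝ), T.card ≤ 2 ^ (k - 1) ∧
    ∀ x : Fin n → ℝ, NX x ≤ 1 → ∃ y ∈ T, NY (x - y) ≤ ε}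

/-- The operator norm of the identity map from `(ℝ^n, NX)` to `(ℝ^n, NY)`:
`‖id‖ = sup {NY x : NX x ≤ 1}`. -/
noncomputable def opNorm (n : ℕ) (NX NY : (Fin n → ℝ) → ℝ) : ℝ :=
  sSup {t : ℝ | ∃ x : Fin n → ℝ, NX x ≤ 1 ∧ t = NY x}

/-- `N` is a quasi-norm on `ℝ^n` with quasi-norm constant at most `C`. -/
def IsQuasiNormWith (n : ℕ) (C : ℝ) (N : (Fin n → ℝ) → ℝ) : Prop :=
  (∀ x, 0 ≤ N x) ∧ (∀ x, N x = 0 ↔ x = 0) ∧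
  (∀ (a : ℝ) (x : Fin n → ℝ), N (a • x) = |a| * N x) ∧
  (∀ x y : Fin n → ℝ, N (x + y) ≤ C * (N x + N y))

/-- `N` is `1`-unconditional with respect to the standard basis of `ℝ^n`. -/
def IsUnconditional (n : ℕ) (N : (Fin n → ℝ) → ℝ) : Prop :=
  ∀ (x ε : Fin n → ℝ), (∀ i, ε i = 1 ∨ ε i = -1) →
    N (fun i => ε i * x i) = N x

/-- `N` is `1`-symmetric with respect to the standard basis of `ℝ^n`. -/
def IsSymmetricNorm (n : ℕ) (N : (Fin n → ℝ) → ℝ) : Prop :=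
  ∀ (x ε : Fin n → ℝ) (π : Equiv.Perm (Fin n)), (∀ i, ε i = 1 ∨ ε i = -1) →
    N (fun i => ε i * x (π i)) = N x

/-- The error of best `s`-term approximation of `x` in the quasi-norm `NY`:
`σ_s(x)_Y = inf {‖x - z‖_Y : z has at most s nonzero coordinates}`. -/
noncomputable def bestSTermApprox (n : ℕ) (NY : (Fin n → ℝ) → ℝ) (s : ℕ) (x : Fin n → ℝ) : ℝ :=
  sInf {t : ℝ | ∃ z : Fin n → ℝ,
    ((Finset.univ : Finset (Fin n)).filter (fun i => z i ≠ 0)).card ≤ s ∧ t = NY (x - z)}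

/-- The truncation functional `u(X, Y, s) = sup { ‖(min{x_s^*, x_i^*})_{i=1}^n‖_Y : ‖x‖_X ≤ 1 }`. -/
noncomputable def truncFunctionalGen (n : ℕ) (NX NY : (Fin n → ℝ) → ℝ) (s : ℕ) : ℝ :=
  sSup {t : ℝ | ∃ x : Fin n → ℝ, NX x ≤ 1 ∧
    t = NY (fun i : Fin n => min (rearr n x s) (rearr n x (i.1 + 1)))}

lemma IsQuasiNormWith.exists_le_of_abs_le_one {n : ℕ} {C : ℝ} {N : (Fin n → ℝ) → ℝ}
    (hC : 1 ≤ C) (hN : IsQuasiNormWith n C N) :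
    ∃ B : ℝ, 0 ≤ B ∧ ∀ y : Fin n → ℝ, (∀ i, |y i| ≤ 1) → N y ≤ B := by
  obtain ⟨h0, hz, hs, ht⟩ := hN
  suffices h : ∀ S : Finset (Fin n), ∃ B : ℝ, 0 ≤ B ∧ ∀ y : Fin n → ℝ, (∀ i, |y i| ≤ 1) →
      (∀ i ∉ S, y i = 0) → N y ≤ B by
    obtain ⟨B, hB, h⟩ := h Finset.univ
    exact ⟨B, hB, fun y hy => h y hy (by simp)⟩
  intro S
  induction S using Finset.induction_on with
  | empty =>
    refine ⟨0, le_rfl, fun y _ hy => ?_⟩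
    exact ((hz y).2 (funext fun i => hy i (by simp))).le
  | insert a S ha ih =>
    obtain ⟨B, hB, ih⟩ := ih
    have he := h0 (Pi.single a 1)
    refine ⟨C * (N (Pi.single a 1) + B), by positivity, fun y hy hyS => ?_⟩
    have hsplit : y = y a • Pi.single a (1 : ℝ) + Function.update y a 0 := by
      ext i
      by_cases hi : i = a
      · subst hi; simp
      · simp [hi]
    have h1 : N (Function.update y a 0) ≤ B := by
      apply ih
      · intro i
        by_cases hi : i = a
        · subst hi; simp
        · simpa [hi] using hy i
      · intro i hi
        by_cases hia : i = a
        · subst hia; simp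
        · simpa [hia] using hyS i (by simp [hi, hia])
    have h2 : N (y a • Pi.single a (1 : ℝ)) ≤ N (Pi.single a 1) := by
      rw [hs]
      exact mul_le_of_le_one_left he (hy a)
    rw [hsplit]
    refine (ht _ _).trans ?_
    gcongr

/-- A sign-invariant quasi-norm controls some coordinatewise `2⁻ᵐ`-approximation of every
multiple `a * x` with `|a i| ≤ 1`, with a constant depending only on `C` and `m`. -/
lemma exists_approx_multiplier {C : ℝ} (hC : 1 ≤ C) (m : ℕ) :
    ∃ K : ℝ, 0 ≤ K ∧ ∀ (n : ℕ) (N : (Fin n → ℝ) → ℝ),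
      IsQuasiNormWith n C N → IsSymmetricNorm n N →
      ∀ x a : Fin n → ℝ, (∀ i, |a i| ≤ 1) →
        ∃ b : Fin n → ℝ, (∀ i, |a i - b i| ≤ (1 / 2) ^ m) ∧
          N (fun i => b i * x i) ≤ K * N x := by
  induction m with
  | zero =>
    refine ⟨0, le_rfl, fun n N hN _ x a ha => ⟨0, by simpa using ha, ?_⟩⟩
    rw [(hN.2.1 _).2 (by ext; simp)]
    simp
  | succ m ih =>
    obtain ⟨K, hK, ih⟩ := ih
    refine ⟨C * (1 / 2 + K / 2), by positivity, fun n N hN hsym x a ha => ?_⟩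
    let ε : Fin n → ℝ := fun i => if 0 ≤ a i then 1 else -1
    obtain ⟨b, hb, hNb⟩ := ih n N hN hsym x (fun i => 2 * a i - ε i) (by
      intro i
      have h := abs_le.1 (ha i)
      rw [abs_le]
      simp only [ε]
      split_ifs <;> constructor <;> linarith)
    refine ⟨fun i => ε i / 2 + b i / 2, fun i => ?_, ?_⟩
    · have h := abs_le.1 (hb i)
      rw [abs_le, pow_succ]
      constructor <;> linarith
    · have hsplit : (fun i => (ε i / 2 + b i / 2) * x i)
          = (1 / 2 : ℝ) • (fun i => ε i * x i) + (1 / 2 : ℝ) • (fun i => b i * x i) := by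
        ext i
        simp only [Pi.add_apply, Pi.smul_apply, smul_eq_mul]
        ring
      have hε : N (fun i => ε i * x i) = N x :=
        hsym x ε 1 (fun i => by simp only [ε]; split_ifs <;> simp)
      rw [hsplit]
      refine (hN.2.2.2 _ _).trans ?_
      rw [hN.2.2.1, hN.2.2.1, hε, abs_of_pos (by norm_num : (0 : ℝ) < 1 / 2), mul_assoc]
      gcongr
      linarith

/-- A symmetric quasi-norm is monotone up to a constant depending only on its quasi-norm
constant. -/
lemma exists_monotone_const {C : ℝ} (hC : 1 ≤ C) :
    ∃ K : ℝ, 0 < K ∧ ∀ (n : ℕ) (N : (Fin n → ℝ) → ℝ),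
      IsQuasiNormWith n C N → IsSymmetricNorm n N →
      ∀ (x y : Fin n → ℝ) (π : Equiv.Perm (Fin n)), (∀ i, |y i| ≤ |x (π i)|) →
        N y ≤ K * N x := by
  obtain ⟨m, hm⟩ := exists_pow_lt_of_lt_one (show (0 : ℝ) < 1 / (2 * C) by positivity)
    (by norm_num : (1 / 2 : ℝ) < 1)
  obtain ⟨K, hK, happ⟩ := exists_approx_multiplier hC m
  refine ⟨2 * C * K + 1, by positivity, fun n N hN hsym => ?_⟩
  have key : ∀ x a : Fin n → ℝ, (∀ i, |a i| ≤ 1) →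
      N (fun i => a i * x i) ≤ 2 * C * K * N x := by
    intro x a ha
    obtain ⟨B, hB, hbound⟩ := hN.exists_le_of_abs_le_one hC
    let T : Set ℝ := {t | ∃ a : Fin n → ℝ, (∀ i, |a i| ≤ 1) ∧ t = N (fun i => a i * x i)}
    have hTbdd : BddAbove T := by
      refine ⟨(‖x‖ + 1) * B, ?_⟩
      rintro _ ⟨a, ha, rfl⟩
      have hx : 0 < ‖x‖ + 1 := by positivity
      have hscale : (fun i => a i * x i) = (‖x‖ + 1) • (fun i => a i * x i / (‖x‖ + 1)) := by
        ext i
        simp only [Pi.smul_apply, smul_eq_mul]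
        field_simp
      rw [hscale, hN.2.2.1, abs_of_pos hx]
      gcongr
      apply hbound
      intro i
      rw [abs_div, abs_mul, abs_of_pos hx, div_le_one hx]
      have h1 : |x i| ≤ ‖x‖ := norm_le_pi_norm x i
      nlinarith [ha i, abs_nonneg (x i), abs_nonneg (a i)]
    have hT : sSup T ≤ C * (K * N x) + sSup T / 2 := by
      refine csSup_le ⟨_, a, ha, rfl⟩ ?_
      rintro _ ⟨a, ha, rfl⟩
      obtain ⟨b, hb, hNb⟩ := happ n N hN hsym x a ha
      let r : Fin n → ℝ := fun i => 2 * C * (a i - b i)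
      have hr : ∀ i, |r i| ≤ 1 := by
        intro i
        have h := (hb i).trans hm.le
        simp only [r]
        rw [abs_mul, abs_of_pos (by positivity)]
        rwa [le_div_iff₀ (by positivity), mul_comm] at h
      have hsplit : (fun i => a i * x i)
          = (fun i => b i * x i) + (1 / (2 * C)) • (fun i => r i * x i) := by
        ext i
        simp only [Pi.add_apply, Pi.smul_apply, smul_eq_mul, r]
        field_simp
        ring
      have hle : N (fun i => r i * x i) ≤ sSup T := le_csSup hTbdd ⟨r, hr, rfl⟩
      rw [hsplit]
      refine (hN.2.2.2 _ _).trans ?_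
      rw [hN.2.2.1, abs_of_pos (by positivity), mul_add]
      have : C * (1 / (2 * C) * N (fun i => r i * x i)) = N (fun i => r i * x i) / 2 := by
        field_simp
      rw [this]
      gcongr
    have hle : N (fun i => a i * x i) ≤ sSup T := le_csSup hTbdd ⟨a, ha, rfl⟩
    linarith
  intro x y π hxy
  have hy : y = fun i => (y i / x (π i)) * x (π i) := by
    ext i
    by_cases h : x (π i) = 0
    · simpa [h] using hxy i
    · field_simp
  have hperm : N (fun i => x (π i)) = N x := by
    simpa using hsym x 1 π (by simp)
  have h := key (fun i => x (π i)) (fun i => y i / x (π i)) (fun i => by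
    rw [abs_div]
    exact div_le_one_of_le₀ (hxy i) (abs_nonneg _))
  rw [← hy, hperm] at h
  linarith [hN.1 x]

lemma exists_perm_mapsTo {α : Type*} [Fintype α] (A B : Finset α)
    (h : A.card ≤ B.card) : ∃ π : Equiv.Perm α, ∀ i ∈ A, π i ∈ B := by
  obtain ⟨B', hB', hcard⟩ := Finset.exists_subset_card_eq h
  let e : {x // x ∈ A} ≃ {x // x ∈ B'} := Finset.equivOfCardEq hcard.symm
  refine ⟨e.extendSubtype, fun i hi => hB' ?_⟩
  exact e.extendSubtype_mem i hi

lemma exists_perm_rearr (n : ℕ) (x : Fin n → ℝ) :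
    ∃ π : Equiv.Perm (Fin n), Antitone (fun i => |x (π i)|) ∧
      ∀ i : Fin n, rearr n x (i.1 + 1) = |x (π i)| := by
  let π := Tuple.sort (fun i => -|x i|)
  have hmono : Monotone (fun i => -|x (π i)|) := Tuple.monotone_sort (fun i => -|x i|)
  have hanti : Antitone (fun i => |x (π i)|) := fun i j hij => neg_le_neg_iff.1 (hmono hij)
  refine ⟨π, hanti, fun i => ?_⟩
  have hcard : ∀ t : ℝ, (Finset.univ.filter (fun j => t < |x j|)).card
      = (Finset.univ.filter (fun j => t < |x (π j)|)).card := by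
    intro t
    refine (Finset.card_bij (fun j _ => π j) ?_ ?_ ?_).symm
    · intro j hj
      simpa using hj
    · intro j _ k _ h
      exact π.injective h
    · intro k hk
      exact ⟨π.symm k, by simpa using hk, by simp⟩
  have hset : {t : ℝ | 0 ≤ t ∧
      ((Finset.univ : Finset (Fin n)).filter (fun j => t < |x j|)).card ≤ i.1 + 1 - 1}
      = Set.Ici |x (π i)| := by
    ext t
    rw [Set.mem_ofPred_eq, Set.mem_Ici, hcard, Nat.add_sub_cancel]
    constructor
    · rintro ⟨_, hc⟩
      by_contra! hlt
      have hsub : Finset.Iic i ⊆ Finset.univ.filter (fun j => t < |x (π j)|) := by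
        intro j hj
        have := hanti (Finset.mem_Iic.1 hj)
        simpa using hlt.trans_le this
      have := Finset.card_le_card hsub
      rw [Fin.card_Iic] at this
      omega
    · intro hle
      refine ⟨(abs_nonneg _).trans hle, ?_⟩
      have hsub : Finset.univ.filter (fun j => t < |x (π j)|) ⊆ Finset.Iio i := by
        intro j hj
        rw [Finset.mem_Iio]
        by_contra! hij
        have h1 : |x (π j)| ≤ |x (π i)| := hanti hij
        have h2 : t < |x (π j)| := by simpa using hj
        linarith
      have := Finset.card_le_card hsub
      rwa [Fin.card_Iio] at this
  rw [rearr, hset, csInf_Ici]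

lemma IsQuasiNormWith.exists_bound_on_unit_ball {n : ℕ} {C K : ℝ} {NX NY : (Fin n → ℝ) → ℝ}
    (hC : 1 ≤ C) (hK : 0 < K) (hX : IsQuasiNormWith n C NX) (hY : IsQuasiNormWith n C NY)
    (hmono : ∀ (x y : Fin n → ℝ) (π : Equiv.Perm (Fin n)), (∀ i, |y i| ≤ |x (π i)|) →
      NX y ≤ K * NX x) :
    ∃ B : ℝ, ∀ x, NX x ≤ 1 → NY x ≤ B := by
  obtain ⟨B, _, hbound⟩ := hY.exists_le_of_abs_le_one hC
  have hpos : ∀ i, 0 < NX (Pi.single i 1) := fun i =>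
    lt_of_le_of_ne (hX.1 _) fun h => by
      have := congrFun ((hX.2.1 _).1 h.symm) i
      simp at this
  let R : ℝ := 1 + ∑ i, K / NX (Pi.single i 1)
  have hterm : ∀ i, 0 ≤ K / NX (Pi.single i 1) := fun i => (div_pos hK (hpos i)).le
  have hR : 0 < R := by
    have := Finset.sum_nonneg fun i (_ : i ∈ Finset.univ) => hterm i
    simp only [R]
    linarith
  refine ⟨R * B, fun x hx => ?_⟩
  have hscale : x = R • (R⁻¹ • x) := by rw [smul_inv_smul₀ hR.ne']
  rw [hscale, hY.2.2.1, abs_of_pos hR]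
  gcongr
  apply hbound
  intro i
  have h1 : |x i| * NX (Pi.single i 1) ≤ K * NX x := by
    rw [← hX.2.2.1]
    apply hmono _ _ 1
    intro j
    by_cases hj : j = i
    · subst hj; simp
    · simp [hj]
  have h2 : |x i| ≤ K / NX (Pi.single i 1) := by
    rw [le_div_iff₀ (hpos i)]
    nlinarith
  have h3 := Finset.single_le_sum (fun j _ => hterm j) (Finset.mem_univ i)
  have h4 : |x i| ≤ R := by simp only [R]; linarith
  rw [Pi.smul_apply, smul_eq_mul, abs_mul, abs_inv, abs_of_pos hR, inv_mul_le_iff₀ hR]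
  linarith

lemma bestSTermApprox_le {n : ℕ} {C : ℝ} {N : (Fin n → ℝ) → ℝ} (hN : IsQuasiNormWith n C N)
    {s : ℕ} (x z : Fin n → ℝ)
    (hz : ((Finset.univ : Finset (Fin n)).filter (fun i => z i ≠ 0)).card ≤ s) :
    bestSTermApprox n N s x ≤ N (x - z) :=
  csInf_le ⟨0, by rintro _ ⟨z, _, rfl⟩; exact hN.1 _⟩ ⟨z, hz, rfl⟩

/-- The truncation `(min {x_s^*, x_i^*})_i` of the rearrangement dominates the error of best
`s`-term approximation. -/
lemma bestSTermApprox_le_trunc {n : ℕ} {C K : ℝ} {N : (Fin n → ℝ) → ℝ}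
    (hN : IsQuasiNormWith n C N)
    (hmono : ∀ (x y : Fin n → ℝ) (π : Equiv.Perm (Fin n)), (∀ i, |y i| ≤ |x (π i)|) →
      N y ≤ K * N x)
    {s : ℕ} (hs : 1 ≤ s) (hsn : s ≤ n) (x : Fin n → ℝ) :
    bestSTermApprox n N s x ≤
      K * N (fun i : Fin n => min (rearr n x s) (rearr n x (i.1 + 1))) := by
  obtain ⟨π, hanti, hr⟩ := exists_perm_rearr n x
  let k : Fin n := ⟨s - 1, by omega⟩
  have hk : rearr n x s = |x (π k)| := by
    rw [← hr k]
    congr 1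
    simp only [k]
    omega
  let z : Fin n → ℝ := fun i => if (π.symm i).1 < s then x i else 0
  have hz : ((Finset.univ : Finset (Fin n)).filter (fun i => z i ≠ 0)).card ≤ s := by
    have hsub : (Finset.univ : Finset (Fin n)).filter (fun i => z i ≠ 0)
        ⊆ (Finset.Iic k).map π.toEmbedding := by
      intro i hi
      have hi' : (π.symm i).1 < s := by
        by_contra h
        simp [z, h] at hi
      rw [Finset.mem_map]
      refine ⟨π.symm i, ?_, by simp⟩
      rw [Finset.mem_Iic, Fin.le_def]
      simp only [k]
      omega
    refine (Finset.card_le_card hsub).trans ?_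
    rw [Finset.card_map, Fin.card_Iic]
    simp only [k]
    omega
  refine (bestSTermApprox_le hN x z hz).trans (hmono _ _ π.symm fun i => ?_)
  rw [hr, hk, abs_of_nonneg (a := min _ _) (le_min (abs_nonneg _) (abs_nonneg _))]
  simp only [Pi.sub_apply, z]
  split_ifs with h
  · simp
  · have hle : k ≤ π.symm i := by
      rw [Fin.le_def]
      simp only [k]
      omega
    rw [sub_zero]
    exact le_min (by simpa using hanti hle) (by simp)

/-- Flattening the first `2 * s` entries of the rearrangement of a unit vector yields, up to
scaling, a unit vector whose error of best `s`-term approximation dominates the truncation. -/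
lemma exists_trunc_le_bestSTermApprox {n : ℕ} {C K : ℝ} {NX NY : (Fin n → ℝ) → ℝ}
    (hC : 1 ≤ C) (hK : 0 < K)
    (hX : IsQuasiNormWith n C NX) (hY : IsQuasiNormWith n C NY)
    (hmonoX : ∀ (x y : Fin n → ℝ) (π : Equiv.Perm (Fin n)), (∀ i, |y i| ≤ |x (π i)|) →
      NX y ≤ K * NX x)
    (hmonoY : ∀ (x y : Fin n → ℝ) (π : Equiv.Perm (Fin n)), (∀ i, |y i| ≤ |x (π i)|) →
      NY y ≤ K * NY x)
    {s : ℕ} (hs : 1 ≤ s) (hsn : 2 * s < n) (x : Fin n → ℝ) (hx : NX x ≤ 1) :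
    ∃ v : Fin n → ℝ, NX v ≤ 1 ∧
      NY (fun i : Fin n => min (rearr n x s) (rearr n x (i.1 + 1))) ≤
        4 * C ^ 2 * K ^ 3 * bestSTermApprox n NY s v := by
  obtain ⟨π, hanti, hr⟩ := exists_perm_rearr n x
  let k : Fin n := ⟨s - 1, by omega⟩
  have hk : rearr n x s = |x (π k)| := by
    rw [← hr k]
    congr 1
    simp only [k]
    omega
  let y : Fin n → ℝ := fun i => if i.1 < 2 * s then |x (π k)| else |x (π i)|
  have hy0 : ∀ i, 0 ≤ y i := fun i => by simp only [y]; split_ifs <;> exact abs_nonneg _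
  have hyk : ∀ i, y i ≤ |x (π k)| := fun i => by
    simp only [y]
    split_ifs with h
    · exact le_rfl
    · refine hanti ?_
      rw [Fin.le_def]
      simp only [k]
      omega
  have hcard_lt : ∀ m, m ≤ n → (Finset.univ.filter (fun i : Fin n => i.1 < m)).card = m := by
    intro m hm
    rw [Fin.card_filter_val_lt]
    omega
  let L : ℝ := 2 * C * K
  have hL : 0 < L := by positivity
  have hNy : NX y ≤ L := by
    let E : Finset (Fin n) := Finset.univ.filter (fun i => i.1 < 2 * s)
    let D : Finset (Fin n) := Finset.univ.filter (fun i => i.1 < s)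
    have hD : D.card = s := hcard_lt s (by omega)
    have hE : E.card = 2 * s := hcard_lt (2 * s) (by omega)
    have hDE : D ⊆ E := by
      intro i hi
      simp only [D, E, Finset.mem_filter, Finset.mem_univ, true_and] at hi ⊢
      omega
    obtain ⟨τ, hτ⟩ := exists_perm_mapsTo (E \ D) D (by
      rw [Finset.card_sdiff_of_subset hDE]
      omega)
    let y₁ : Fin n → ℝ := fun i => if i ∈ E \ D then 0 else y i
    let y₂ : Fin n → ℝ := fun i => if i ∈ E \ D then y i else 0
    have hsplit : y = y₁ + y₂ := by
      ext i
      simp only [y₁, y₂, Pi.add_apply]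
      split_ifs <;> simp
    have hDk : ∀ i ∈ D, |x (π k)| ≤ |x (π i)| := by
      intro i hi
      refine hanti ?_
      simp only [D, Finset.mem_filter, Finset.mem_univ, true_and] at hi
      rw [Fin.le_def]
      simp only [k]
      omega
    have h1 : NX y₁ ≤ K * NX x := by
      apply hmonoX _ _ π
      intro i
      simp only [y₁]
      split_ifs with h
      · simp
      · rw [abs_of_nonneg (hy0 i)]
        by_cases hiD : i ∈ D
        · exact (hyk i).trans (hDk i hiD)
        · have hiE : i ∉ E := fun hiE => h (Finset.mem_sdiff.2 ⟨hiE, hiD⟩)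
          have : ¬ i.1 < 2 * s := by simpa [E] using hiE
          simp [y, this]
    have h2 : NX y₂ ≤ K * NX x := by
      apply hmonoX _ _ (τ.trans π)
      intro i
      simp only [y₂, Equiv.trans_apply]
      split_ifs with h
      · rw [abs_of_nonneg (hy0 i)]
        exact (hyk i).trans (hDk _ (hτ i h))
      · simp
    rw [hsplit]
    refine (hX.2.2.2 _ _).trans ?_
    have h3 : NX y₁ + NX y₂ ≤ 2 * K := by nlinarith
    calc C * (NX y₁ + NX y₂) ≤ C * (2 * K) := by gcongr
      _ = L := by simp only [L]; ring
  let v : Fin n → ℝ := L⁻¹ • y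
  have hv0 : ∀ i, 0 ≤ v i := fun i => mul_nonneg (inv_pos.2 hL).le (hy0 i)
  refine ⟨v, ?_, ?_⟩
  · simp only [v]
    rw [hX.2.2.1, abs_inv, abs_of_pos hL, inv_mul_le_iff₀ hL]
    linarith
  have hw : NY (fun i : Fin n => min (rearr n x s) (rearr n x (i.1 + 1))) ≤ K * (L * NY v) := by
    have hLv : NY y = L * NY v := by
      simp only [v]
      rw [hY.2.2.1, abs_inv, abs_of_pos hL, mul_inv_cancel_left₀ hL.ne']
    rw [← hLv]
    apply hmonoY _ _ 1
    intro i
    rw [hr, hk, abs_of_nonneg (le_min (abs_nonneg _) (abs_nonneg _)), Equiv.Perm.one_apply,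
      abs_of_nonneg (hy0 i)]
    simp only [y]
    split_ifs
    · exact min_le_left _ _
    · exact min_le_right _ _
  have hmain : ∀ z : Fin n → ℝ,
      ((Finset.univ : Finset (Fin n)).filter (fun i => z i ≠ 0)).card ≤ s →
      NY v ≤ L * NY (v - z) := by
    intro z hz
    set A : Finset (Fin n) := (Finset.univ : Finset (Fin n)).filter (fun i => z i ≠ 0) with hA
    have hzA : ∀ i ∉ A, z i = 0 := fun i hi => by simpa [hA] using hi
    let E : Finset (Fin n) := Finset.univ.filter (fun i => i.1 < 2 * s)
    have hE : E.card = 2 * s := hcard_lt (2 * s) (by omega)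
    obtain ⟨τ, hτ⟩ := exists_perm_mapsTo A (E \ A) (by
      have := Finset.le_card_sdiff A E
      omega)
    let v₁ : Fin n → ℝ := fun i => if i ∈ A then 0 else v i
    let v₂ : Fin n → ℝ := fun i => if i ∈ A then v i else 0
    have hsplit : v = v₁ + v₂ := by
      ext i
      simp only [v₁, v₂, Pi.add_apply]
      split_ifs <;> simp
    have h1 : NY v₁ ≤ K * NY (v - z) := by
      apply hmonoY _ _ 1
      intro i
      simp only [v₁]
      split_ifs with h
      · simp
      · simp [hzA i h]
    have h2 : NY v₂ ≤ K * NY (v - z) := by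
      apply hmonoY _ _ τ
      intro i
      simp only [v₂]
      split_ifs with h
      · obtain ⟨hτE, hτA⟩ := Finset.mem_sdiff.1 (hτ i h)
        have hlt : (τ i).1 < 2 * s := by simpa [E] using hτE
        have hyτ : y (τ i) = |x (π k)| := by simp [y, hlt]
        rw [Pi.sub_apply, hzA _ hτA, sub_zero, abs_of_nonneg (hv0 _), abs_of_nonneg (hv0 _)]
        simp only [v, Pi.smul_apply, smul_eq_mul, hyτ]
        exact mul_le_mul_of_nonneg_left (hyk i) (inv_pos.2 hL).le
      · simp
    calc NY v = NY (v₁ + v₂) := by rw [← hsplit]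
      _ ≤ C * (NY v₁ + NY v₂) := hY.2.2.2 _ _
      _ ≤ C * (K * NY (v - z) + K * NY (v - z)) := by gcongr
      _ = L * NY (v - z) := by simp only [L]; ring
  have hbest : L⁻¹ * NY v ≤ bestSTermApprox n NY s v := by
    refine le_csInf ⟨_, 0, by simp, rfl⟩ ?_
    rintro _ ⟨z, hz, rfl⟩
    rw [inv_mul_le_iff₀ hL]
    exact hmain z hz
  rw [inv_mul_le_iff₀ hL] at hbest
  calc _ ≤ K * (L * NY v) := hw
    _ ≤ K * (L * (L * bestSTermApprox n NY s v)) := by gcongr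
    _ = 4 * C ^ 2 * K ^ 3 * bestSTermApprox n NY s v := by simp only [L]; ring

/-- For `1`-symmetric quasi-norms `‖·‖_X, ‖·‖_Y` on `ℝ^n` with quasi-norm constants at most
`C₀` and `1 ≤ s < n/2`, the worst-case best `s`-term approximation error over the unit ball
of `X` is equivalent to the truncation functional `u(X, Y, s)`, with constants depending
only on `C₀`. -/
theorem bestSTermApprox_equiv_truncFunctional
    (C₀ : ℝ) (hC₀ : 1 ≤ C₀) :
    ∃ c C : ℝ, 0 < c ∧ 0 < C ∧
      ∀ (n : ℕ) (NX NY : (Fin n → ℝ) → ℝ),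
        IsQuasiNormWith n C₀ NX → IsSymmetricNorm n NX →
        IsQuasiNormWith n C₀ NY → IsSymmetricNorm n NY →
        ∀ s : ℕ, 1 ≤ s → 2 * s < n →
          c * truncFunctionalGen n NX NY s ≤
              sSup {t : ℝ | ∃ x : Fin n → ℝ, NX x ≤ 1 ∧ t = bestSTermApprox n NY s x} ∧
            sSup {t : ℝ | ∃ x : Fin n → ℝ, NX x ≤ 1 ∧ t = bestSTermApprox n NY s x} ≤
              C * truncFunctionalGen n NX NY s := by
  obtain ⟨K, hK, hmono⟩ := exists_monotone_const hC₀
  have hM : 0 < 4 * C₀ ^ 2 * K ^ 3 := by positivity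
  refine ⟨(4 * C₀ ^ 2 * K ^ 3)⁻¹, K, inv_pos.2 hM, hK, ?_⟩
  intro n NX NY hX hXs hY hYs s hs hsn
  have hmX := hmono n NX hX hXs
  have hmY := hmono n NY hY hYs
  have hX0 : NX 0 ≤ 1 := by rw [(hX.2.1 0).2 rfl]; exact zero_le_one
  have hbddU : BddAbove {t : ℝ | ∃ x : Fin n → ℝ, NX x ≤ 1 ∧
      t = NY (fun i : Fin n => min (rearr n x s) (rearr n x (i.1 + 1)))} := by
    obtain ⟨B, hB⟩ := hX.exists_bound_on_unit_ball hC₀ hK hY hmX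
    refine ⟨K * B, ?_⟩
    rintro _ ⟨x, hx, rfl⟩
    refine le_trans ?_ (mul_le_mul_of_nonneg_left (hB x hx) hK.le)
    obtain ⟨π, -, hr⟩ := exists_perm_rearr n x
    have hnonneg : 0 ≤ rearr n x s := Real.sInf_nonneg fun t ht => ht.1
    apply hmY _ _ π
    intro i
    rw [hr, abs_of_nonneg (le_min hnonneg (abs_nonneg _))]
    exact min_le_right _ _
  have hupper : ∀ x, NX x ≤ 1 → bestSTermApprox n NY s x ≤ K * truncFunctionalGen n NX NY s :=
    fun x hx => (bestSTermApprox_le_trunc hY hmY hs (by omega) x).trans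
      (mul_le_mul_of_nonneg_left (le_csSup hbddU ⟨x, hx, rfl⟩) hK.le)
  constructor
  · rw [inv_mul_le_iff₀ hM]
    refine csSup_le ⟨_, 0, hX0, rfl⟩ ?_
    rintro _ ⟨x, hx, rfl⟩
    obtain ⟨v, hv, hle⟩ := exists_trunc_le_bestSTermApprox hC₀ hK hX hY hmX hmY hs hsn x hx
    refine hle.trans (mul_le_mul_of_nonneg_left
      (le_csSup ⟨K * truncFunctionalGen n NX NY s, ?_⟩ ⟨v, hv, rfl⟩) hM.le)
    rintro _ ⟨x, hx, rfl⟩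
    exact hupper x hx
  · refine csSup_le ⟨_, 0, hX0, rfl⟩ ?_
    rintro _ ⟨x, hx, rfl⟩
    exact hupper x hx
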